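/- (Interpretation lemma) Two functional rewrite rules r₁ = (p₁ ↦ p₂) and r₂ = (p₁′ ↦ p₂′) are equivalent if and only if they justify exactly the same rewrites on patterns: r₁ ≡ r₂ iff for all patterns p and q, (there exists a substitution σ with σ[p₁] = p and σ[p₂] = q) if and only if (there exists a substitution τ with τ[p₁′] = p and τ[p₂′] = q). -/

import Mathlib

inductive Pattern (K X : Type) : Type
  | var : X → Pattern K X
  | con : K → List (Pattern K X) → Pattern K X

abbrev Subst (K X : Type) : Type := X → Pattern K X

def Pattern.subst {K X : Type} (σ : Subst K X) : Pattern K X → Pattern K X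
  | .var x => σ x
  | .con k ps => .con k (ps.attach.map fun q => Pattern.subst σ q.1)
termination_by p => sizeOf p
decreasing_by
  have := List.sizeOf_lt_of_mem q.2
  simp only [Pattern.con.sizeOf_spec]
  omega

def scomp {K X : Type} (σ₁ σ₂ : Subst K X) : Subst K X :=
  fun x => (σ₂ x).subst σ₁

def Factors {K X : Type} (σ₁ σ₂ : Subst K X) : Prop :=
  ∃ σ₃, σ₁ = scomp σ₃ σ₂

def Unifies {K X : Type} (σ₁ σ₂ : Subst K X) (p₁ p₂ : Pattern K X) : Prop :=
  p₁.subst σ₁ = p₂.subst σ₂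

def IsMGU {K X : Type} (σ₁ σ₂ : Subst K X) (p₁ p₂ : Pattern K X) : Prop :=
  Unifies σ₁ σ₂ p₁ p₂ ∧
  ∀ σ₁' σ₂' : Subst K X, Unifies σ₁' σ₂' p₁ p₂ → Factors σ₁' σ₁ ∧ Factors σ₂' σ₂

inductive IsGround {K X : Type} : Pattern K X → Prop
  | con (k : K) (ps : List (Pattern K X)) : (∀ p ∈ ps, IsGround p) → IsGround (.con k ps)

inductive VarOccurs {K X : Type} (x : X) : Pattern K X → Prop
  | var : VarOccurs x (.var x)
  | con (k : K) (ps : List (Pattern K X)) (p : Pattern K X) :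
      p ∈ ps → VarOccurs x p → VarOccurs x (.con k ps)

abbrev Rule (K X : Type) : Type := Pattern K X × Pattern K X

def Functional {K X : Type} (r : Rule K X) : Prop :=
  ∀ x, VarOccurs x r.2 → VarOccurs x r.1

def Step {K X : Type} (r : Rule K X) (t₁ t₂ : Pattern K X) : Prop :=
  ∃ σ : Subst K X, r.1.subst σ = t₁ ∧ r.2.subst σ = t₂

def ComposedBy {K X : Type} (r₁ r₂ r : Rule K X) : Prop :=
  ∃ σ₁ σ₂ : Subst K X, IsMGU σ₁ σ₂ r₁.2 r₂.1 ∧ r = (r₁.1.subst σ₁, r₂.2.subst σ₂)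

def RuleEquiv {K X : Type} (r r' : Rule K X) : Prop :=
  ∃ σ₁ σ₂ : Subst K X,
    r.1.subst σ₁ = r'.1 ∧ r.2.subst σ₁ = r'.2 ∧
    r'.1.subst σ₂ = r.1 ∧ r'.2.subst σ₂ = r.2

def StepSet {K X : Type} (R : Set (Rule K X)) (t₁ t₂ : Pattern K X) : Prop :=
  ∃ r ∈ R, Step r t₁ t₂

def Evaluates {K X : Type} (R : Set (Rule K X)) (t₁ t₂ : Pattern K X) : Prop :=
  Relation.ReflTransGen (StepSet R) t₁ t₂ ∧ ∀ t₃, ¬ StepSet R t₂ t₃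

theorem Pattern.subst_con {K X : Type} (σ : Subst K X) (k : K) (ps : List (Pattern K X)) :
    (Pattern.con k ps).subst σ = .con k (ps.map (Pattern.subst σ)) := by
  rw [Pattern.subst, List.attach_map_val]

theorem Pattern.subst_var_id {K X : Type} : (p : Pattern K X) → p.subst Pattern.var = p
  | .var x => by rw [Pattern.subst]
  | .con k ps => by
    rw [Pattern.subst_con, List.map_congr_left (g := id) fun q _ => Pattern.subst_var_id q,
      List.map_id]

theorem Pattern.subst_subst {K X : Type} (σ τ : Subst K X) :
    (p : Pattern K X) → (p.subst τ).subst σ = p.subst (scomp σ τ)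
  | .var x => by simp only [Pattern.subst, scomp]
  | .con k ps => by
    simp only [Pattern.subst_con, List.map_map]
    congr 1
    exact List.map_congr_left fun q _ => Pattern.subst_subst σ τ q

theorem rule_equiv_iff_same_rewrites {K X : Type} [Countable X] [Infinite X]
    (p₁ p₂ p₁' p₂' : Pattern K X)
    (hf : Functional (p₁, p₂)) (hf' : Functional (p₁', p₂')) :
    RuleEquiv (p₁, p₂) (p₁', p₂') ↔
      ∀ p q : Pattern K X,
        (∃ σ : Subst K X, p₁.subst σ = p ∧ p₂.subst σ = q) ↔
        (∃ τ : Subst K X, p₁'.subst τ = p ∧ p₂'.subst τ = q) := by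
  constructor
  · rintro ⟨σ₁, σ₂, h₁, h₂, h₃, h₄⟩ p q
    dsimp only at h₁ h₂ h₃ h₄
    constructor
    · rintro ⟨σ, rfl, rfl⟩
      exact ⟨scomp σ σ₂, by rw [← Pattern.subst_subst, h₃], by rw [← Pattern.subst_subst, h₄]⟩
    · rintro ⟨τ, rfl, rfl⟩
      exact ⟨scomp τ σ₁, by rw [← Pattern.subst_subst, h₁], by rw [← Pattern.subst_subst, h₂]⟩
  · intro h
    obtain ⟨σ₁, h₁, h₂⟩ := (h p₁' p₂').2 ⟨_, p₁'.subst_var_id, p₂'.subst_var_id⟩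
    obtain ⟨σ₂, h₃, h₄⟩ := (h p₁ p₂).1 ⟨_, p₁.subst_var_id, p₂.subst_var_id⟩
    exact ⟨σ₁, σ₂, h₁, h₂, h₃, h₄⟩
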